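/- For all geometric graphs G, H in ℝ^d, GGD(G,H) ≤ GED(G,H) ≤ (1 + Δ·C_E/C_V)·GGD(G,H), where Δ denotes the maximum vertex degree over the graphs G and H. -/

import Mathlib

open scoped Classical
noncomputable section

/-- Points of the ambient Euclidean space `ℝ^d`. -/
abbrev Pt (d : ℕ) := EuclideanSpace ℝ (Fin d)

/-- A combinatorial graph embedded in `ℝ^d`: a finite vertex set of points together with a
finite set of (oriented representatives of) straight-line edges, recorded as pairs of points. -/
structure EGraph (d : ℕ) where
  verts : Finset (Pt d)
  edges : Finset (Pt d × Pt d)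

/-- A geometric graph of `ℝ^d`: the straight-line segments realizing the edges intersect
(possibly) only at shared endpoints. -/
structure GeoGraph (d : ℕ) extends EGraph d where
  edge_fst_mem : ∀ e ∈ edges, e.1 ∈ verts
  edge_snd_mem : ∀ e ∈ edges, e.2 ∈ verts
  edge_ne : ∀ e ∈ edges, e.1 ≠ e.2
  segments_meet_at_endpoints : ∀ e ∈ edges, ∀ f ∈ edges, e ≠ f →
    ∀ p ∈ segment ℝ e.1 e.2 ∩ segment ℝ f.1 f.2,
      (p = e.1 ∨ p = e.2) ∧ (p = f.1 ∨ p = f.2)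

/-- `Vol G`: the total edge length of `G`. -/
def EGraph.vol {d : ℕ} (G : EGraph d) : ℝ := ∑ e ∈ G.edges, dist e.1 e.2

/-- The degree of a vertex `u`: the number of edges incident to `u`. -/
def EGraph.degree {d : ℕ} (G : EGraph d) (u : Pt d) : ℕ :=
  (G.edges.filter (fun e => e.1 = u ∨ e.2 = u)).card

/-- The maximum vertex degree of a graph. -/
def EGraph.maxDegree {d : ℕ} (G : EGraph d) : ℕ := G.verts.sup G.degree

/-- A graph has no isolated vertex when every vertex has an incident edge. -/
def NoIsolated {d : ℕ} (G : EGraph d) : Prop :=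
  ∀ u ∈ G.verts, ∃ e ∈ G.edges, e.1 = u ∨ e.2 = u

/-- A state during an editing process: an abstract (labelled) combinatorial graph together
with an embedding of its vertices into `ℝ^d`.  Intermediate states need not be geometric
graphs (positions may even coincide). -/
structure EState (d : ℕ) where
  verts : Finset ℕ
  pos : ℕ → Pt d
  edges : Finset (ℕ × ℕ)

/-- A state represents a geometric graph when its embedded image is exactly that graph. -/
def EState.Represents {d : ℕ} (S : EState d) (G : EGraph d) : Prop :=
  Set.InjOn S.pos ↑S.verts ∧
  S.verts.image S.pos = G.verts ∧
  (∀ e ∈ S.edges, e.1 ∈ S.verts ∧ e.2 ∈ S.verts) ∧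
  S.edges.image (fun e => (S.pos e.1, S.pos e.2)) = G.edges

/-- The elementary edit operations. -/
inductive EditOp (d : ℕ) where
  | delVert (i : ℕ)
  | insVert (i : ℕ) (p : Pt d)
  | delEdge (i j : ℕ)
  | insEdge (i j : ℕ)
  | moveVert (i : ℕ) (p : Pt d)

namespace EditOp

/-- The effect of an edit operation on a state. -/
def apply {d : ℕ} (S : EState d) : EditOp d → EState d
  | delVert i => ⟨S.verts.erase i, S.pos, S.edges⟩
  | insVert i p => ⟨insert i S.verts, Function.update S.pos i p, S.edges⟩
  | delEdge i j => ⟨S.verts, S.pos, S.edges.erase (i, j)⟩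
  | insEdge i j => ⟨S.verts, S.pos, insert (i, j) S.edges⟩
  | moveVert i p => ⟨S.verts, Function.update S.pos i p, S.edges⟩

/-- Legality of an edit operation on a state: only isolated existing vertices may be deleted,
inserted vertices are new, deleted edges exist, and inserted edges join existing vertices. -/
def legal {d : ℕ} (S : EState d) : EditOp d → Prop
  | delVert i => i ∈ S.verts ∧ ∀ e ∈ S.edges, e.1 ≠ i ∧ e.2 ≠ i
  | insVert i _ => i ∉ S.verts
  | delEdge i j => (i, j) ∈ S.edges
  | insEdge i j => i ∈ S.verts ∧ j ∈ S.verts ∧ (i, j) ∉ S.edges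
  | moveVert i _ => i ∈ S.verts

/-- The cost of an edit operation: vertex insertion/deletion is free, edge insertion/deletion
costs `C_E` times the edge length, and translating a vertex costs `C_V` times the displacement
plus `C_E` times the total change in length of all incident edges. -/
def cost {d : ℕ} (CV CE : ℝ) (S : EState d) : EditOp d → ℝ
  | delVert _ => 0
  | insVert _ _ => 0
  | delEdge i j => CE * dist (S.pos i) (S.pos j)
  | insEdge i j => CE * dist (S.pos i) (S.pos j)
  | moveVert i p => CV * dist (S.pos i) p +
      ∑ e ∈ S.edges,
        CE * |dist (Function.update S.pos i p e.1) (Function.update S.pos i p e.2)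
                - dist (S.pos e.1) (S.pos e.2)|

/-- The inverse of an edit operation (relative to the state it is applied to). -/
def inv {d : ℕ} (S : EState d) : EditOp d → EditOp d
  | delVert i => insVert i (S.pos i)
  | insVert i _ => delVert i
  | delEdge i j => insEdge i j
  | insEdge i j => delEdge i j
  | moveVert i _ => moveVert i (S.pos i)

end EditOp

/-- Applying a sequence of edit operations. -/
def applyPath {d : ℕ} (S : EState d) (P : List (EditOp d)) : EState d :=
  P.foldl EditOp.apply S

/-- Every operation of the sequence is legal on the intermediate result it is applied to. -/
def legalPath {d : ℕ} : EState d → List (EditOp d) → Prop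
  | _, [] => True
  | S, o :: P => EditOp.legal S o ∧ legalPath (EditOp.apply S o) P

/-- The cost of an edit path: the sum of the costs of its individual edits. -/
def pathCost {d : ℕ} (CV CE : ℝ) : EState d → List (EditOp d) → ℝ
  | _, [] => 0
  | S, o :: P => EditOp.cost CV CE S o + pathCost CV CE (EditOp.apply S o) P

/-- The inverse edit path: the reversed sequence of the inverse operations. -/
def invPath {d : ℕ} : EState d → List (EditOp d) → List (EditOp d)
  | _, [] => []
  | S, o :: P => invPath (EditOp.apply S o) P ++ [EditOp.inv S o]

/-- `P` is an edit path from `G` to `H`, starting at the representing state `S`. -/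
def IsEditPathFrom {d : ℕ} (G H : EGraph d) (S : EState d) (P : List (EditOp d)) : Prop :=
  S.Represents G ∧ legalPath S P ∧ (applyPath S P).Represents H

/-- The geometric edit distance: the infimum cost of an edit path from `G` to `H`. -/
def GED {d : ℕ} (CV CE : ℝ) (G H : GeoGraph d) : ℝ :=
  sInf {c : ℝ | ∃ (S : EState d) (P : List (EditOp d)),
    IsEditPathFrom G.toEGraph H.toEGraph S P ∧ pathCost CV CE S P = c}

/-- Distance between possibly-dummy vertices: `|a − ε_V| = 0`. -/
def odist {d : ℕ} : Option (Pt d) → Option (Pt d) → ℝ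
  | some a, some b => dist a b
  | _, _ => 0

/-- Length of a possibly-dummy edge: `|ε_E| = 0`. -/
def elen {d : ℕ} : Option (Pt d × Pt d) → ℝ
  | some e => dist e.1 e.2
  | none => 0

/-- One step of the evolution of the vertex with label `i` under an edit operation;
a deleted vertex is recorded as the dummy vertex `none` and stays dummy. -/
def vStep {d : ℕ} (i : ℕ) (o : EditOp d) (s : Option (Pt d)) : Option (Pt d) :=
  match s, o with
  | none, _ => none
  | some _, .delVert j => if j = i then none else s
  | some _, .moveVert j p => if j = i then some p else s
  | some _, _ => s

/-- The end result `P(u)` of the evolution of the vertex with label `i` under the path `P`. -/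
def vTrack {d : ℕ} (i : ℕ) (P : List (EditOp d)) (s : Option (Pt d)) : Option (Pt d) :=
  P.foldl (fun s o => vStep i o s) s

/-- The cost of the orbit of the vertex with label `i`:
`C_V` times the total displacement along the orbit. -/
def vOrbitCost {d : ℕ} (CV : ℝ) (i : ℕ) : Option (Pt d) → List (EditOp d) → ℝ
  | _, [] => 0
  | s, o :: P => CV * odist s (vStep i o s) + vOrbitCost CV i (vStep i o s) P

/-- One step of the evolution of the edge with label pair `(i, j)` under an edit operation;
a deleted edge (or an edge losing an endpoint) is recorded as the dummy edge `none`. -/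
def eStep {d : ℕ} (i j : ℕ) (o : EditOp d) (s : Option (Pt d × Pt d)) :
    Option (Pt d × Pt d) :=
  match s, o with
  | none, _ => none
  | some _, .delEdge a b => if a = i ∧ b = j then none else s
  | some _, .delVert a => if a = i ∨ a = j then none else s
  | some q, .moveVert a p =>
      if a = i then some (p, q.2) else if a = j then some (q.1, p) else s
  | some _, _ => s

/-- The end result `P(e)` of the evolution of the edge with label pair `(i, j)` under `P`. -/
def eTrack {d : ℕ} (i j : ℕ) (P : List (EditOp d)) (s : Option (Pt d × Pt d)) :
    Option (Pt d × Pt d) :=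
  P.foldl (fun s o => eStep i j o s) s

/-- The cost of the orbit of the edge with label pair `(i, j)`:
`C_E` times the total variation of its length along the orbit. -/
def eOrbitCost {d : ℕ} (CE : ℝ) (i j : ℕ) : Option (Pt d × Pt d) → List (EditOp d) → ℝ
  | _, [] => 0
  | s, o :: P => CE * |elen (eStep i j o s) - elen s| + eOrbitCost CE i j (eStep i j o s) P

/-- An inexact matching between `G` and `H`: every vertex of `G` is matched with exactly one
vertex of `H` or with the dummy vertex (`none`), and conversely, consistently. -/
structure Matching (d : ℕ) (G H : EGraph d) where
  f : Pt d → Option (Pt d)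
  g : Pt d → Option (Pt d)
  f_mem : ∀ u ∈ G.verts, ∀ v, f u = some v → v ∈ H.verts
  g_mem : ∀ v ∈ H.verts, ∀ u, g v = some u → u ∈ G.verts
  consistent : ∀ u ∈ G.verts, ∀ v ∈ H.verts, (f u = some v ↔ g v = some u)

/-- The image `π(e) = (π(u₁), π(u₂))` of an edge under a matching: it is the dummy edge `none`
if either endpoint is matched with the dummy vertex, or if the image is not an edge of the
target graph `T`. -/
def mEdge {d : ℕ} (T : EGraph d) (φ : Pt d → Option (Pt d)) (e : Pt d × Pt d) :
    Option (Pt d × Pt d) :=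
  match φ e.1, φ e.2 with
  | some a, some b => if (a, b) ∈ T.edges then some (a, b) else none
  | _, _ => none

/-- The cost of an inexact matching: vertex translations, edge translations, and deletions of
the unmatched edges from both graphs. -/
def matchCost {d : ℕ} (CV CE : ℝ) {G H : EGraph d} (m : Matching d G H) : ℝ :=
  (∑ u ∈ G.verts.filter (fun u => m.f u ≠ none), CV * odist (some u) (m.f u)) +
  (∑ e ∈ G.edges.filter (fun e => mEdge H m.f e ≠ none),
      CE * |dist e.1 e.2 - elen (mEdge H m.f e)|) +
  (∑ e ∈ G.edges.filter (fun e => mEdge H m.f e = none), CE * dist e.1 e.2) +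
  (∑ f ∈ H.edges.filter (fun f => mEdge G m.g f = none), CE * dist f.1 f.2)

/-- The geometric graph distance: the minimum cost of an inexact matching. -/
def GGD {d : ℕ} (CV CE : ℝ) (G H : GeoGraph d) : ℝ :=
  sInf {c : ℝ | ∃ m : Matching d G.toEGraph H.toEGraph, matchCost CV CE m = c}

/-- The point `(a, b)` of `ℝ²`. -/
def pt2 (a b : ℝ) : Pt 2 := (WithLp.equiv 2 (Fin 2 → ℝ)).symm ![a, b]

/-- The point `a` of `ℝ¹`. -/
def pt1 (a : ℝ) : Pt 1 := (WithLp.equiv 2 (Fin 1 → ℝ)).symm ![a]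

/-! ### Lower bound -/

def EState.WF {d : ℕ} (S : EState d) : Prop :=
  ∀ e ∈ S.edges, e.1 ∈ S.verts ∧ e.2 ∈ S.verts

/-- Length of a labelled edge in a state, zero when it is not an edge. -/
def labLen {d : ℕ} (S : EState d) (e : ℕ × ℕ) : ℝ :=
  if e ∈ S.edges then dist (S.pos e.1) (S.pos e.2) else 0

def labCost {d : ℕ} (S T : EState d) (M : Finset ℕ) (e : ℕ × ℕ) : ℝ :=
  if e.1 ∈ M ∧ e.2 ∈ M then |labLen S e - labLen T e| else labLen S e + labLen T e

lemma labLen_nonneg {d : ℕ} (S : EState d) (e : ℕ × ℕ) : 0 ≤ labLen S e := by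
  unfold labLen; split_ifs
  · exact dist_nonneg
  · exact le_rfl

lemma labCost_nonneg {d : ℕ} (S T : EState d) (M : Finset ℕ) (e : ℕ × ℕ) :
    0 ≤ labCost S T M e := by
  unfold labCost; split_ifs
  · exact abs_nonneg _
  · exact add_nonneg (labLen_nonneg _ _) (labLen_nonneg _ _)

lemma labCost_triangle {d : ℕ} (S S' T : EState d) (M : Finset ℕ) (e : ℕ × ℕ) :
    labCost S T M e ≤ labCost S' T M e + |labLen S' e - labLen S e| := by
  unfold labCost
  split_ifs
  · have := abs_sub_le (labLen S e) (labLen S' e) (labLen T e)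
    rw [abs_sub_comm (labLen S' e) (labLen S e)]
    linarith
  · have := neg_abs_le (labLen S' e - labLen S e)
    linarith

lemma sum_labCost_triangle {d : ℕ} (CE : ℝ) (hCE : 0 < CE) (S S' T : EState d) (M : Finset ℕ)
    (D E : Finset (ℕ × ℕ)) (hE : ∀ e, e ∉ E → labLen S' e = labLen S e) :
    ∑ e ∈ D, CE * labCost S T M e ≤ ∑ e ∈ D, CE * labCost S' T M e +
      ∑ e ∈ E, CE * |labLen S' e - labLen S e| := by
  have h1 : ∑ e ∈ D, CE * labCost S T M e ≤ ∑ e ∈ D, CE * labCost S' T M e +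
      ∑ e ∈ D, CE * |labLen S' e - labLen S e| := by
    rw [← Finset.sum_add_distrib]
    apply Finset.sum_le_sum
    intro e _
    rw [← mul_add]
    exact mul_le_mul_of_nonneg_left (labCost_triangle _ _ _ _ _) hCE.le
  have h2 : ∑ e ∈ D, CE * |labLen S' e - labLen S e| ≤
      ∑ e ∈ E, CE * |labLen S' e - labLen S e| := by
    have h3 : ∑ e ∈ D ∩ E, CE * |labLen S' e - labLen S e| =
        ∑ e ∈ D, CE * |labLen S' e - labLen S e| := by
      apply Finset.sum_subset Finset.inter_subset_left
      intro e he he'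
      have : e ∉ E := fun h => he' (Finset.mem_inter.2 ⟨he, h⟩)
      rw [hE e this]; simp
    rw [← h3]
    apply Finset.sum_le_sum_of_subset_of_nonneg Finset.inter_subset_right
    intro e _ _
    positivity
  linarith

lemma WF.apply {d : ℕ} {S : EState d} (hS : S.WF) (o : EditOp d) (ho : EditOp.legal S o) :
    (EditOp.apply S o).WF := by
  intro e he
  cases o with
  | delVert i =>
    have h := ho.2 e he
    have h' := hS e he
    exact ⟨Finset.mem_erase.2 ⟨h.1, h'.1⟩, Finset.mem_erase.2 ⟨h.2, h'.2⟩⟩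
  | insVert i p =>
    have h' := hS e he
    exact ⟨Finset.mem_insert_of_mem h'.1, Finset.mem_insert_of_mem h'.2⟩
  | delEdge i j => exact hS e (Finset.mem_of_mem_erase he)
  | insEdge i j =>
    rcases Finset.mem_insert.1 he with rfl | h
    · exact ⟨ho.1, ho.2.1⟩
    · exact hS e h
  | moveVert i p => exact hS e he

lemma lower_path {d : ℕ} (CV CE : ℝ) (hCV : 0 < CV) (hCE : 0 < CE) (P : List (EditOp d)) :
    ∀ S : EState d, S.WF → legalPath S P →
      ∃ M : Finset ℕ, M ⊆ S.verts ∧ M ⊆ (applyPath S P).verts ∧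
        ∀ D : Finset (ℕ × ℕ),
          ∑ i ∈ M, CV * dist (S.pos i) ((applyPath S P).pos i) +
          ∑ e ∈ D, CE * labCost S (applyPath S P) M e ≤ pathCost CV CE S P := by
  induction P with
  | nil =>
    intro S hS _
    refine ⟨S.verts, subset_rfl, subset_rfl, ?_⟩
    intro D
    have : ∀ e, labCost S S S.verts e = 0 := by
      intro e
      unfold labCost
      split_ifs with h
      · simp
      · have : e ∉ S.edges := fun h' => h (hS e h')
        simp [labLen, this]
    simp [applyPath, pathCost, this]
  | cons o P ih =>
    intro S hS hl
    obtain ⟨ho, hl⟩ := hl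
    obtain ⟨M, hM1, hM2, hM⟩ := ih _ (WF.apply hS o ho) hl
    have hap : applyPath S (o :: P) = applyPath (EditOp.apply S o) P := rfl
    rw [hap]
    have hpc : pathCost CV CE S (o :: P) =
      EditOp.cost CV CE S o + pathCost CV CE (EditOp.apply S o) P := rfl
    rw [hpc]
    generalize hT : applyPath (EditOp.apply S o) P = T at *
    generalize hc : pathCost CV CE (EditOp.apply S o) P = c at *
    cases o with
    | delVert i =>
      refine ⟨M, hM1.trans (Finset.erase_subset _ _), hM2, ?_⟩
      intro D
      have := hM D
      have h2 : ∀ e, labCost (EditOp.apply S (.delVert i)) T M e = labCost S T M e := by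
        intro e; rfl
      simp only [h2] at this
      simpa [EditOp.cost, EditOp.apply] using this
    | insVert i p =>
      have hi : i ∉ S.verts := ho
      refine ⟨M.erase i, ?_, (Finset.erase_subset _ _).trans hM2, ?_⟩
      · intro k hk
        have hk' := Finset.mem_erase.1 hk
        have := hM1 hk'.2
        exact (Finset.mem_insert.1 this).resolve_left hk'.1
      intro D
      have h1 := hM D
      have hL : ∀ e, labLen (EditOp.apply S (.insVert i p)) e = labLen S e := by
        intro e
        unfold labLen
        by_cases he : e ∈ S.edges
        · have h3 := hS e he
          have h4 : e.1 ≠ i := fun h => hi (h ▸ h3.1)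
          have h5 : e.2 ≠ i := fun h => hi (h ▸ h3.2)
          simp [EditOp.apply, he, h4, h5]
        · simp [EditOp.apply, he]
      have h2 : ∀ e, labCost S T (M.erase i) e ≤
          labCost (EditOp.apply S (.insVert i p)) T M e := by
        intro e
        unfold labCost
        rw [hL]
        have ha := labLen_nonneg S e
        have hb := labLen_nonneg T e
        by_cases hm : e.1 ∈ M ∧ e.2 ∈ M
        · rw [if_pos hm]
          split_ifs with hm'
          · exact le_rfl
          · have : e ∉ S.edges := by
              intro he
              have h3 := hS e he
              have h4 : e.1 ≠ i := fun h => hi (h ▸ h3.1)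
              have h5 : e.2 ≠ i := fun h => hi (h ▸ h3.2)
              exact hm' ⟨Finset.mem_erase.2 ⟨h4, hm.1⟩, Finset.mem_erase.2 ⟨h5, hm.2⟩⟩
            have h0 : labLen S e = 0 := by simp [labLen, this]
            rw [h0]; simp [abs_of_nonneg hb]
        · have hm' : ¬ (e.1 ∈ M.erase i ∧ e.2 ∈ M.erase i) := fun h =>
            hm ⟨Finset.mem_of_mem_erase h.1, Finset.mem_of_mem_erase h.2⟩
          rw [if_neg hm, if_neg hm']
      have h3 : ∑ k ∈ M.erase i, CV * dist (S.pos k) (T.pos k) ≤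
          ∑ k ∈ M, CV * dist ((EditOp.apply S (.insVert i p)).pos k) (T.pos k) := by
        calc _ = ∑ k ∈ M.erase i,
              CV * dist ((EditOp.apply S (.insVert i p)).pos k) (T.pos k) := by
              apply Finset.sum_congr rfl
              intro k hk
              have := (Finset.mem_erase.1 hk).1
              simp [EditOp.apply, this]
          _ ≤ _ := by
              apply Finset.sum_le_sum_of_subset_of_nonneg (Finset.erase_subset _ _)
              intro k _ _
              positivity
      have h4 : ∑ e ∈ D, CE * labCost S T (M.erase i) e ≤
          ∑ e ∈ D, CE * labCost (EditOp.apply S (.insVert i p)) T M e :=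
        Finset.sum_le_sum fun e _ => mul_le_mul_of_nonneg_left (h2 e) hCE.le
      simp only [EditOp.cost]
      linarith
    | delEdge i j =>
      refine ⟨M, hM1, hM2, ?_⟩
      intro D
      have h1 := hM D
      have hij : (i, j) ∈ S.edges := ho
      have h2 := sum_labCost_triangle CE hCE S (EditOp.apply S (.delEdge i j)) T M D {(i, j)} (by
        intro e he
        have he' : e ≠ (i, j) := by simpa using he
        simp [labLen, EditOp.apply, he'])
      rw [Finset.sum_singleton] at h2
      have h3 : |labLen (EditOp.apply S (.delEdge i j)) (i, j) - labLen S (i, j)| =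
          dist (S.pos i) (S.pos j) := by
        simp [labLen, EditOp.apply, hij]
      rw [h3] at h2
      have h4 : (EditOp.apply S (.delEdge i j)).pos = S.pos := rfl
      rw [h4] at h1
      simp only [EditOp.cost]
      linarith
    | insEdge i j =>
      refine ⟨M, hM1, hM2, ?_⟩
      intro D
      have h1 := hM D
      have hij : (i, j) ∉ S.edges := ho.2.2
      have h2 := sum_labCost_triangle CE hCE S (EditOp.apply S (.insEdge i j)) T M D {(i, j)} (by
        intro e he
        have he' : e ≠ (i, j) := by simpa using he
        simp [labLen, EditOp.apply, he'])
      rw [Finset.sum_singleton] at h2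
      have h3 : |labLen (EditOp.apply S (.insEdge i j)) (i, j) - labLen S (i, j)| =
          dist (S.pos i) (S.pos j) := by
        simp [labLen, EditOp.apply, hij]
      rw [h3] at h2
      have h4 : (EditOp.apply S (.insEdge i j)).pos = S.pos := rfl
      rw [h4] at h1
      simp only [EditOp.cost]
      linarith
    | moveVert i p =>
      refine ⟨M, hM1, hM2, ?_⟩
      intro D
      have h1 := hM D
      have h2 := sum_labCost_triangle CE hCE S (EditOp.apply S (.moveVert i p)) T M D S.edges (by
        intro e he
        simp [labLen, EditOp.apply, he])
      have h3 : ∑ e ∈ S.edges, CE * |labLen (EditOp.apply S (.moveVert i p)) e - labLen S e| =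
          ∑ e ∈ S.edges,
        CE * |dist (Function.update S.pos i p e.1) (Function.update S.pos i p e.2)
                - dist (S.pos e.1) (S.pos e.2)| := by
        apply Finset.sum_congr rfl
        intro e he
        simp [labLen, EditOp.apply, he]
      rw [h3] at h2
      have h5 : ∑ k ∈ M, CV * dist (S.pos k) (T.pos k) ≤
          ∑ k ∈ M, CV * dist ((EditOp.apply S (.moveVert i p)).pos k) (T.pos k) +
            CV * dist (S.pos i) p := by
        calc _ ≤ ∑ k ∈ M, (CV * dist ((EditOp.apply S (.moveVert i p)).pos k) (T.pos k) +
              if k = i then CV * dist (S.pos i) p else 0) := by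
              apply Finset.sum_le_sum
              intro k _
              by_cases hk : k = i
              · subst hk
                simp only [EditOp.apply, Function.update_self, if_true]
                rw [← mul_add, add_comm]
                exact mul_le_mul_of_nonneg_left (dist_triangle _ _ _) hCV.le
              · simp [EditOp.apply, hk]
          _ ≤ _ := by
              rw [Finset.sum_add_distrib, Finset.sum_ite_eq']
              have : 0 ≤ CV * dist (S.pos i) p := by positivity
              split_ifs <;> linarith
      simp only [EditOp.cost]
      linarith

/-! ### Upper bound: building blocks -/

def Reach {d : ℕ} (CV CE : ℝ) (S T : EState d) (c : ℝ) : Prop :=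
  ∃ P : List (EditOp d), legalPath S P ∧ applyPath S P = T ∧ pathCost CV CE S P ≤ c

lemma legalPath_append {d : ℕ} (P Q : List (EditOp d)) : ∀ S : EState d,
    legalPath S P → legalPath (applyPath S P) Q → legalPath S (P ++ Q) := by
  induction P with
  | nil => intro S _ h; exact h
  | cons o P ih => intro S h h'; exact ⟨h.1, ih _ h.2 h'⟩

lemma pathCost_append {d : ℕ} (CV CE : ℝ) (P Q : List (EditOp d)) : ∀ S : EState d,
    pathCost CV CE S (P ++ Q) = pathCost CV CE S P + pathCost CV CE (applyPath S P) Q := by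
  induction P with
  | nil => intro S; simp [pathCost, applyPath]
  | cons o P ih =>
    intro S
    simp only [List.cons_append, pathCost, ih]
    simp only [applyPath, List.foldl_cons]
    ring

lemma Reach.trans {d : ℕ} {CV CE : ℝ} {S T U : EState d} {a b : ℝ}
    (h : Reach CV CE S T a) (h' : Reach CV CE T U b) : Reach CV CE S U (a + b) := by
  obtain ⟨P, h1, h2, h3⟩ := h
  obtain ⟨Q, k1, k2, k3⟩ := h'
  subst h2
  refine ⟨P ++ Q, legalPath_append _ _ _ h1 k1, ?_, ?_⟩
  · simpa [applyPath, List.foldl_append] using k2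
  · rw [pathCost_append]; linarith

lemma Reach.refl {d : ℕ} {CV CE : ℝ} (S : EState d) : Reach CV CE S S 0 :=
  ⟨[], trivial, rfl, le_rfl⟩

lemma Reach.single {d : ℕ} {CV CE : ℝ} (S : EState d) (o : EditOp d) (h : EditOp.legal S o) :
    Reach CV CE S (EditOp.apply S o) (EditOp.cost CV CE S o) :=
  ⟨[o], ⟨h, trivial⟩, rfl, by simp [pathCost]⟩

lemma Reach.congr {d : ℕ} {CV CE : ℝ} {S T T' : EState d} {a b : ℝ}
    (h : Reach CV CE S T a) (hT : T = T') (hab : a ≤ b) : Reach CV CE S T' b := by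
  obtain ⟨P, h1, h2, h3⟩ := h
  exact ⟨P, h1, h2.trans hT, h3.trans hab⟩

lemma reach_delEdges {d : ℕ} (CV CE : ℝ) (V : Finset ℕ) (p : ℕ → Pt d) (E D : Finset (ℕ × ℕ))
    (hD : D ⊆ E) :
    Reach CV CE ⟨V, p, E⟩ ⟨V, p, E \ D⟩ (∑ e ∈ D, CE * dist (p e.1) (p e.2)) := by
  induction D using Finset.induction_on with
  | empty => exact (Reach.refl _).congr (by simp) (by simp)
  | insert a D ha ih =>
    have h1 := ih ((Finset.subset_insert _ _).trans hD)
    have h2 := Reach.single (CV := CV) (CE := CE) (⟨V, p, E \ D⟩ : EState d) (.delEdge a.1 a.2)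
      (Finset.mem_sdiff.2 ⟨hD (Finset.mem_insert_self _ _), ha⟩)
    refine (h1.trans h2).congr ?_ ?_
    · simp only [EditOp.apply, EState.mk.injEq, true_and]
      ext e; simp only [Finset.mem_erase, Finset.mem_sdiff, Finset.mem_insert]; tauto
    · rw [Finset.sum_insert ha, add_comm]; exact le_rfl

lemma reach_delVerts {d : ℕ} (CV CE : ℝ) (V D : Finset ℕ) (p : ℕ → Pt d) (E : Finset (ℕ × ℕ))
    (hD : D ⊆ V) (hE : ∀ e ∈ E, e.1 ∉ D ∧ e.2 ∉ D) :
    Reach CV CE ⟨V, p, E⟩ ⟨V \ D, p, E⟩ 0 := by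
  induction D using Finset.induction_on with
  | empty => exact (Reach.refl _).congr (by simp) (by simp)
  | insert a D ha ih =>
    have h1 := ih ((Finset.subset_insert _ _).trans hD) (fun e he =>
      ⟨fun h => (hE e he).1 (Finset.mem_insert_of_mem h),
       fun h => (hE e he).2 (Finset.mem_insert_of_mem h)⟩)
    have h2 := Reach.single (CV := CV) (CE := CE) (⟨V \ D, p, E⟩ : EState d) (.delVert a)
      ⟨Finset.mem_sdiff.2 ⟨hD (Finset.mem_insert_self _ _), ha⟩, fun e he =>
        ⟨fun h => (hE e he).1 (h ▸ Finset.mem_insert_self _ _),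
         fun h => (hE e he).2 (h ▸ Finset.mem_insert_self _ _)⟩⟩
    refine (h1.trans h2).congr ?_ ?_
    · simp only [EditOp.apply, EState.mk.injEq, and_true]
      ext e; simp only [Finset.mem_erase, Finset.mem_sdiff, Finset.mem_insert]; tauto
    · simp [EditOp.cost]

lemma reach_insVerts {d : ℕ} (CV CE : ℝ) (V B : Finset ℕ) (p q : ℕ → Pt d)
    (E : Finset (ℕ × ℕ)) (hB : ∀ i ∈ B, i ∉ V) :
    Reach CV CE ⟨V, p, E⟩ ⟨V ∪ B, fun i => if i ∈ B then q i else p i, E⟩ 0 := by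
  induction B using Finset.induction_on with
  | empty => exact (Reach.refl _).congr (by simp) (by simp)
  | insert a B ha ih =>
    have h1 := ih (fun i hi => hB i (Finset.mem_insert_of_mem hi))
    have h2 := Reach.single (CV := CV) (CE := CE)
      (⟨V ∪ B, fun i => if i ∈ B then q i else p i, E⟩ : EState d) (.insVert a (q a))
      (by
        have := hB a (Finset.mem_insert_self _ _)
        simp [EditOp.legal, ha, this])
    refine (h1.trans h2).congr ?_ ?_
    · simp only [EditOp.apply, EState.mk.injEq, and_true]
      constructor
      · ext e; simp only [Finset.mem_union, Finset.mem_insert]; tauto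
      · funext i
        by_cases hi : i = a
        · subst hi; simp
        · simp [hi]
    · simp [EditOp.cost]

lemma reach_insEdges {d : ℕ} (CV CE : ℝ) (V : Finset ℕ) (p : ℕ → Pt d) (E F : Finset (ℕ × ℕ))
    (hF : ∀ e ∈ F, e.1 ∈ V ∧ e.2 ∈ V ∧ e ∉ E) :
    Reach CV CE ⟨V, p, E⟩ ⟨V, p, E ∪ F⟩ (∑ e ∈ F, CE * dist (p e.1) (p e.2)) := by
  induction F using Finset.induction_on with
  | empty => exact (Reach.refl _).congr (by simp) (by simp)
  | insert a F ha ih =>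
    have h1 := ih (fun i hi => hF i (Finset.mem_insert_of_mem hi))
    have h3 := hF a (Finset.mem_insert_self _ _)
    have h2 := Reach.single (CV := CV) (CE := CE) (⟨V, p, E ∪ F⟩ : EState d) (.insEdge a.1 a.2)
      ⟨h3.1, h3.2.1, by simp [h3.2.2, ha]⟩
    refine (h1.trans h2).congr ?_ ?_
    · simp only [EditOp.apply, EState.mk.injEq, true_and]
      ext e; simp only [Finset.mem_union, Finset.mem_insert]; tauto
    · rw [Finset.sum_insert ha, add_comm]; exact le_rfl

lemma cost_moveVert_le {d : ℕ} (CV CE : ℝ) (hCE : 0 < CE) (S : EState d) (Δ : ℝ) (i : ℕ) (p : Pt d)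
    (hΔ : ((S.edges.filter (fun e => e.1 = i ∨ e.2 = i)).card : ℝ) ≤ Δ)
    (hloop : ∀ e ∈ S.edges, e.1 ≠ e.2) :
    EditOp.cost CV CE S (.moveVert i p) ≤ (CV + Δ * CE) * dist (S.pos i) p := by
  simp only [EditOp.cost]
  have h : ∑ e ∈ S.edges,
        CE * |dist (Function.update S.pos i p e.1) (Function.update S.pos i p e.2)
                - dist (S.pos e.1) (S.pos e.2)| ≤
      ∑ e ∈ S.edges, if (e.1 = i ∨ e.2 = i) then CE * dist (S.pos i) p else 0 := by
    apply Finset.sum_le_sum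
    intro e he
    have hne := hloop e he
    by_cases h1 : e.1 = i
    · have h2 : e.2 ≠ i := fun h => hne (h1.trans h.symm)
      simp only [h1, h2, true_or, if_true, Function.update_self, ne_eq, not_false_eq_true,
        Function.update_of_ne]
      apply mul_le_mul_of_nonneg_left _ hCE.le
      rw [dist_comm (S.pos i) p]
      exact abs_dist_sub_le _ _ _
    · by_cases h2 : e.2 = i
      · simp only [h1, h2, or_true, if_true, Function.update_self, ne_eq, not_false_eq_true,
          Function.update_of_ne]
        apply mul_le_mul_of_nonneg_left _ hCE.le
        rw [dist_comm (S.pos e.1) p, dist_comm (S.pos e.1), dist_comm (S.pos i) p]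
        exact abs_dist_sub_le _ _ _
      · simp [h1, h2]
  rw [← Finset.sum_filter, Finset.sum_const, nsmul_eq_mul] at h
  have h2 : ((S.edges.filter (fun e => e.1 = i ∨ e.2 = i)).card : ℝ) * (CE * dist (S.pos i) p) ≤
      Δ * (CE * dist (S.pos i) p) := mul_le_mul_of_nonneg_right hΔ (by positivity)
  nlinarith

lemma reach_moves {d : ℕ} (CV CE : ℝ) (hCE : 0 < CE) (V A : Finset ℕ) (p q : ℕ → Pt d)
    (E : Finset (ℕ × ℕ)) (Δ : ℝ) (hA : A ⊆ V)
    (hΔ : ∀ i ∈ A, ((E.filter (fun e => e.1 = i ∨ e.2 = i)).card : ℝ) ≤ Δ)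
    (hloop : ∀ e ∈ E, e.1 ≠ e.2) :
    Reach CV CE ⟨V, p, E⟩ ⟨V, fun i => if i ∈ A then q i else p i, E⟩
      (∑ i ∈ A, (CV + Δ * CE) * dist (p i) (q i)) := by
  induction A using Finset.induction_on with
  | empty => exact (Reach.refl _).congr (by simp) (by simp)
  | insert a A ha ih =>
    have h1 := ih ((Finset.subset_insert _ _).trans hA)
      (fun i hi => hΔ i (Finset.mem_insert_of_mem hi))
    have h2 := Reach.single (CV := CV) (CE := CE)
      (⟨V, fun i => if i ∈ A then q i else p i, E⟩ : EState d) (.moveVert a (q a))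
      (hA (Finset.mem_insert_self _ _))
    refine (h1.trans h2).congr ?_ ?_
    · simp only [EditOp.apply, EState.mk.injEq, and_true, true_and]
      funext i
      by_cases hi : i = a
      · subst hi; simp
      · simp [hi]
    · rw [Finset.sum_insert ha, add_comm]
      have := cost_moveVert_le CV CE hCE (⟨V, fun i => if i ∈ A then q i else p i, E⟩ : EState d)
        Δ a (q a) (hΔ a (Finset.mem_insert_self _ _)) hloop
      simp only [ha, if_false] at this
      linarith

lemma reach_states {d : ℕ} (CV CE : ℝ) (hCE : 0 < CE) (V W : Finset ℕ) (p q : ℕ → Pt d)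
    (E F : Finset (ℕ × ℕ)) (Δ : ℝ)
    (hF : ∀ e ∈ F, e.1 ∈ W ∧ e.2 ∈ W)
    (hΔ : ∀ i ∈ V, ((E.filter (fun e => e.1 = i ∨ e.2 = i)).card : ℝ) ≤ Δ)
    (hloop : ∀ e ∈ E, e.1 ≠ e.2) :
    ∃ r : ℕ → Pt d, (∀ i ∈ W, r i = q i) ∧
    Reach CV CE ⟨V, p, E⟩ ⟨W, r, F⟩
      (∑ e ∈ E \ F, CE * dist (p e.1) (p e.2) + ∑ i ∈ V ∩ W, (CV + Δ * CE) * dist (p i) (q i)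
        + ∑ e ∈ F \ E, CE * dist (q e.1) (q e.2)) := by
  have s1 := reach_delEdges CV CE V p E (E \ F) Finset.sdiff_subset
  rw [sdiff_sdiff_right_self] at s1
  change Reach CV CE _ ⟨V, p, E ∩ F⟩ _ at s1
  have s2 := reach_delVerts CV CE V (V \ W) p (E ∩ F) Finset.sdiff_subset (by
    intro e he
    have he' := Finset.mem_inter.1 he
    have := hF e he'.2
    simp [this.1, this.2])
  rw [sdiff_sdiff_right_self] at s2
  change Reach CV CE _ ⟨V ∩ W, p, E ∩ F⟩ _ at s2
  have s3 := reach_moves CV CE hCE (V ∩ W) (V ∩ W) p q (E ∩ F) Δ subset_rfl (by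
    intro i hi
    refine le_trans ?_ (hΔ i (Finset.mem_inter.1 hi).1)
    exact_mod_cast Finset.card_le_card
      (Finset.filter_subset_filter _ Finset.inter_subset_left))
    (fun e he => hloop e (Finset.mem_inter.1 he).1)
  set p3 : ℕ → Pt d := fun i => if i ∈ V ∩ W then q i else p i with hp3
  have s4 := reach_insVerts CV CE (V ∩ W) (W \ V) p3 q (E ∩ F) (by
    intro i hi; simp only [Finset.mem_sdiff] at hi; simp [hi.2])
  set p4 : ℕ → Pt d := fun i => if i ∈ W \ V then q i else p3 i with hp4
  have hVW : V ∩ W ∪ W \ V = W := by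
    ext i; simp only [Finset.mem_union, Finset.mem_inter, Finset.mem_sdiff]; tauto
  rw [hVW] at s4
  have hr : ∀ i ∈ W, p4 i = q i := by
    intro i hi
    by_cases hv : i ∈ V <;> simp [hp4, hp3, hi, hv]
  have s5 := reach_insEdges CV CE W p4 (E ∩ F) (F \ E) (by
    intro e he
    have he' := Finset.mem_sdiff.1 he
    have := hF e he'.1
    exact ⟨this.1, this.2, fun h => he'.2 (Finset.mem_inter.1 h).1⟩)
  have hEF : E ∩ F ∪ F \ E = F := by
    ext i; simp only [Finset.mem_union, Finset.mem_inter, Finset.mem_sdiff]; tauto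
  rw [hEF] at s5
  refine ⟨p4, hr, ((((s1.trans s2).trans s3).trans s4).trans s5).congr rfl ?_⟩
  have : ∑ e ∈ F \ E, CE * dist (p4 e.1) (p4 e.2) = ∑ e ∈ F \ E, CE * dist (q e.1) (q e.2) := by
    apply Finset.sum_congr rfl
    intro e he
    have := hF e (Finset.mem_sdiff.1 he).1
    rw [hr _ this.1, hr _ this.2]
  rw [this]
  linarith

/-! ### From paths to matchings -/

lemma mEdge_ne_none {d : ℕ} {T : EGraph d} {φ : Pt d → Option (Pt d)} {e : Pt d × Pt d}
    (h : mEdge T φ e ≠ none) : ∃ a b, φ e.1 = some a ∧ φ e.2 = some b ∧ (a, b) ∈ T.edges := by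
  unfold mEdge at h
  cases h1 : φ e.1 with
  | none => simp [h1] at h
  | some a =>
    cases h2 : φ e.2 with
    | none => simp [h1, h2] at h
    | some b =>
      refine ⟨a, b, rfl, rfl, ?_⟩
      by_contra h3
      simp [h1, h2, h3] at h

def track {d : ℕ} (M : Finset ℕ) (p q : ℕ → Pt d) (u : Pt d) : Option (Pt d) :=
  if h : ∃ i ∈ M, p i = u then some (q h.choose) else none

lemma track_pos {d : ℕ} {M : Finset ℕ} {p q : ℕ → Pt d} (hp : Set.InjOn p ↑M) {i : ℕ}
    (hi : i ∈ M) : track M p q (p i) = some (q i) := by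
  have h : ∃ j ∈ M, p j = p i := ⟨i, hi, rfl⟩
  have h2 : h.choose = i := hp h.choose_spec.1 hi h.choose_spec.2
  unfold track
  rw [dif_pos h, h2]

lemma track_some {d : ℕ} {M : Finset ℕ} {p q : ℕ → Pt d} {u v : Pt d}
    (h : track M p q u = some v) : ∃ i ∈ M, p i = u ∧ q i = v := by
  unfold track at h
  split_ifs at h with h1
  exact ⟨h1.choose, h1.choose_spec.1, h1.choose_spec.2, Option.some.inj h⟩

def trackMatching {d : ℕ} (G H : EGraph d) (S T : EState d) (M : Finset ℕ)
    (hS : S.Represents G) (hT : T.Represents H) (h1 : M ⊆ S.verts) (h2 : M ⊆ T.verts) :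
    Matching d G H where
  f := track M S.pos T.pos
  g := track M T.pos S.pos
  f_mem := by
    intro u _ v h
    obtain ⟨i, hi, _, rfl⟩ := track_some h
    rw [← hT.2.1]
    exact Finset.mem_image_of_mem _ (h2 hi)
  g_mem := by
    intro u _ v h
    obtain ⟨i, hi, _, rfl⟩ := track_some h
    rw [← hS.2.1]
    exact Finset.mem_image_of_mem _ (h1 hi)
  consistent := by
    intro u _ v _
    constructor
    · intro h
      obtain ⟨i, hi, rfl, rfl⟩ := track_some h
      exact track_pos (hT.1.mono (by exact_mod_cast h2)) hi
    · intro h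
      obtain ⟨i, hi, rfl, rfl⟩ := track_some h
      exact track_pos (hS.1.mono (by exact_mod_cast h1)) hi

lemma mem_edges_iff {d : ℕ} {G : EGraph d} {S : EState d} (hS : S.Represents G) {e : ℕ × ℕ}
    (h1 : e.1 ∈ S.verts) (h2 : e.2 ∈ S.verts) :
    (S.pos e.1, S.pos e.2) ∈ G.edges ↔ e ∈ S.edges := by
  rw [← hS.2.2.2, Finset.mem_image]
  constructor
  · rintro ⟨x, hx, hxe⟩
    have hv := hS.2.2.1 x hx
    have ha : x.1 = e.1 := hS.1 hv.1 h1 (congrArg Prod.fst hxe)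
    have hb : x.2 = e.2 := hS.1 hv.2 h2 (congrArg Prod.snd hxe)
    have : x = e := Prod.ext ha hb
    exact this ▸ hx
  · intro h; exact ⟨e, h, rfl⟩

lemma mEdge_track {d : ℕ} {G H : EGraph d} {S T : EState d} {M : Finset ℕ}
    (hS : S.Represents G) (hT : T.Represents H) (h1 : M ⊆ S.verts) (h2 : M ⊆ T.verts)
    {e : ℕ × ℕ} (he : e ∈ S.edges) :
    mEdge H (track M S.pos T.pos) (S.pos e.1, S.pos e.2) =
      if (e.1 ∈ M ∧ e.2 ∈ M) ∧ e ∈ T.edges then some (T.pos e.1, T.pos e.2) else none := by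
  have hinj : Set.InjOn S.pos ↑M := hS.1.mono (by exact_mod_cast h1)
  by_cases hm : e.1 ∈ M ∧ e.2 ∈ M
  · unfold mEdge
    simp only [track_pos hinj hm.1, track_pos hinj hm.2, hm, and_self, true_and,
      mem_edges_iff hT (h2 hm.1) (h2 hm.2)]
  · have hn : ¬ ((e.1 ∈ M ∧ e.2 ∈ M) ∧ e ∈ T.edges) := fun h => hm h.1
    rw [if_neg hn]
    by_contra hc
    obtain ⟨a, b, ha, hb, -⟩ := mEdge_ne_none hc
    obtain ⟨i, hi, hi', -⟩ := track_some ha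
    obtain ⟨j, hj, hj', -⟩ := track_some hb
    have hv := hS.2.2.1 e he
    have e1 : i = e.1 := hS.1 (h1 hi) hv.1 hi'
    have e2 : j = e.2 := hS.1 (h1 hj) hv.2 hj'
    exact hm ⟨e1 ▸ hi, e2 ▸ hj⟩

lemma sum_edges {d : ℕ} {G : EGraph d} {S : EState d} (hS : S.Represents G)
    (w : Pt d × Pt d → ℝ) :
    ∑ e ∈ G.edges, w e = ∑ e ∈ S.edges, w (S.pos e.1, S.pos e.2) := by
  rw [← hS.2.2.2, Finset.sum_image]
  intro x hx y hy hxy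
  have hvx := hS.2.2.1 x hx
  have hvy := hS.2.2.1 y hy
  exact Prod.ext (hS.1 hvx.1 hvy.1 (congrArg Prod.fst hxy))
    (hS.1 hvx.2 hvy.2 (congrArg Prod.snd hxy))

lemma matchCost_track_le {d : ℕ} (CV CE : ℝ) (hCV : 0 < CV) (hCE : 0 < CE) (G H : EGraph d)
    (S T : EState d) (M : Finset ℕ)
    (hS : S.Represents G) (hT : T.Represents H) (h1 : M ⊆ S.verts) (h2 : M ⊆ T.verts) :
    matchCost CV CE (trackMatching G H S T M hS hT h1 h2) ≤
      ∑ i ∈ M, CV * dist (S.pos i) (T.pos i) +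
        ∑ e ∈ S.edges ∪ T.edges, CE * labCost S T M e := by
  have hinj : Set.InjOn S.pos ↑M := hS.1.mono (by exact_mod_cast h1)
  unfold matchCost
  have hf : (trackMatching G H S T M hS hT h1 h2).f = track M S.pos T.pos := rfl
  have hg : (trackMatching G H S T M hS hT h1 h2).g = track M T.pos S.pos := rfl
  rw [hf, hg]
  have hA : ∑ u ∈ G.verts.filter (fun u => track M S.pos T.pos u ≠ none),
      CV * odist (some u) (track M S.pos T.pos u) ≤ ∑ i ∈ M, CV * dist (S.pos i) (T.pos i) := by
    calc _ ≤ ∑ u ∈ M.image S.pos, CV * odist (some u) (track M S.pos T.pos u) := by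
          apply Finset.sum_le_sum_of_subset_of_nonneg
          · intro u hu
            obtain ⟨v, hv⟩ := Option.ne_none_iff_exists'.1 (Finset.mem_filter.1 hu).2
            obtain ⟨i, hi, rfl, -⟩ := track_some hv
            exact Finset.mem_image_of_mem _ hi
          · intro u _ _
            apply mul_nonneg hCV.le
            cases track M S.pos T.pos u with
            | none => exact le_rfl
            | some v => exact dist_nonneg
      _ = ∑ i ∈ M, CV * dist (S.pos i) (T.pos i) := by
          rw [Finset.sum_image hinj]
          apply Finset.sum_congr rfl
          intro i hi
          rw [track_pos hinj hi]; rfl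
  have hB : ∑ e ∈ G.edges.filter (fun e => mEdge H (track M S.pos T.pos) e ≠ none),
      CE * |dist e.1 e.2 - elen (mEdge H (track M S.pos T.pos) e)| +
      ∑ e ∈ G.edges.filter (fun e => mEdge H (track M S.pos T.pos) e = none),
        CE * dist e.1 e.2 =
      ∑ e ∈ S.edges, if (e.1 ∈ M ∧ e.2 ∈ M) ∧ e ∈ T.edges then
          CE * |dist (S.pos e.1) (S.pos e.2) - dist (T.pos e.1) (T.pos e.2)|
        else CE * dist (S.pos e.1) (S.pos e.2) := by
    rw [Finset.sum_filter, Finset.sum_filter, sum_edges hS, sum_edges hS,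
      ← Finset.sum_add_distrib]
    apply Finset.sum_congr rfl
    intro e he
    rw [mEdge_track hS hT h1 h2 he]
    by_cases hc : (e.1 ∈ M ∧ e.2 ∈ M) ∧ e ∈ T.edges
    · simp only [if_pos hc]; simp [elen]
    · simp only [if_neg hc]; simp
  have hC : ∑ e ∈ H.edges.filter (fun e => mEdge G (track M T.pos S.pos) e = none),
        CE * dist e.1 e.2 =
      ∑ e ∈ T.edges, if (e.1 ∈ M ∧ e.2 ∈ M) ∧ e ∈ S.edges then 0
        else CE * dist (T.pos e.1) (T.pos e.2) := by
    rw [Finset.sum_filter, sum_edges hT]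
    apply Finset.sum_congr rfl
    intro e he
    rw [mEdge_track hT hS h2 h1 he]
    by_cases hc : (e.1 ∈ M ∧ e.2 ∈ M) ∧ e ∈ S.edges
    · simp only [if_pos hc]; simp
    · simp only [if_neg hc]; simp
  have hD : ∀ (E F : Finset (ℕ × ℕ)) (w : ℕ × ℕ → ℝ), E ⊆ F →
      ∑ e ∈ E, w e = ∑ e ∈ F, if e ∈ E then w e else 0 := by
    intro E F w hEF
    rw [← Finset.sum_filter, Finset.filter_mem_eq_inter, Finset.inter_eq_right.2 hEF]
  rw [hD S.edges (S.edges ∪ T.edges) _ Finset.subset_union_left] at hB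
  rw [hD T.edges (S.edges ∪ T.edges) _ Finset.subset_union_right] at hC
  rw [add_assoc (Finset.sum _ _) (Finset.sum _ _) (Finset.sum _ _), hB, hC, add_assoc,
    ← Finset.sum_add_distrib]
  apply add_le_add hA
  apply Finset.sum_le_sum
  intro e _
  unfold labCost labLen
  by_cases hm : e.1 ∈ M ∧ e.2 ∈ M
  · by_cases ha : e ∈ S.edges <;> by_cases hb : e ∈ T.edges <;>
      simp [hm, ha, hb]
  · by_cases ha : e ∈ S.edges <;> by_cases hb : e ∈ T.edges <;>
      simp [hm, ha, hb, mul_add]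

/-! ### From matchings to paths -/

lemma represents_label {d : ℕ} (G : GeoGraph d) (a : Pt d → ℕ) (r : ℕ → Pt d)
    (hr : ∀ u ∈ G.verts, r (a u) = u) :
    (⟨G.verts.image a, r, G.edges.image (Prod.map a a)⟩ : EState d).Represents G.toEGraph := by
  refine ⟨?_, ?_, ?_, ?_⟩
  · intro x hx y hy hxy
    obtain ⟨u, hu, rfl⟩ := Finset.mem_image.1 (Finset.mem_coe.1 hx)
    obtain ⟨v, hv, rfl⟩ := Finset.mem_image.1 (Finset.mem_coe.1 hy)
    have hxy' : r (a u) = r (a v) := hxy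
    rw [hr u hu, hr v hv] at hxy'
    rw [hxy']
  · simp only [Finset.image_image]
    ext u
    simp only [Finset.mem_image, Function.comp]
    constructor
    · rintro ⟨v, hv, rfl⟩; rwa [hr v hv]
    · intro hu; exact ⟨u, hu, hr u hu⟩
  · intro e he
    obtain ⟨x, hx, rfl⟩ := Finset.mem_image.1 he
    exact ⟨Finset.mem_image_of_mem _ (G.edge_fst_mem x hx),
      Finset.mem_image_of_mem _ (G.edge_snd_mem x hx)⟩
  · simp only [Finset.image_image]
    have key : ∀ x ∈ G.edges, (r (a x.1), r (a x.2)) = x := by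
      intro x hx
      rw [hr _ (G.edge_fst_mem x hx), hr _ (G.edge_snd_mem x hx)]
    ext x
    simp only [Finset.mem_image, Function.comp, Prod.map_fst, Prod.map_snd]
    constructor
    · rintro ⟨v, hv, rfl⟩; rwa [key v hv]
    · intro hu; exact ⟨x, hu, key x hu⟩

lemma sum_edge_label_le {d : ℕ} (CE : ℝ) (hCE : 0 < CE) (G H : GeoGraph d)
    (φ : Pt d → Option (Pt d)) (a b : Pt d → ℕ) (p : ℕ → Pt d)
    (hp : ∀ u ∈ G.verts, p (a u) = u)
    (hab : ∀ u ∈ G.verts, ∀ v ∈ H.verts, φ u = some v → a u = b v) :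
    ∑ e ∈ G.edges.image (Prod.map a a) \ H.edges.image (Prod.map b b),
      CE * dist (p e.1) (p e.2) ≤
    ∑ e ∈ G.edges.filter (fun e => mEdge H.toEGraph φ e = none), CE * dist e.1 e.2 := by
  have hainj : ∀ u ∈ G.verts, ∀ v ∈ G.verts, a u = a v → u = v := by
    intro u hu v hv h
    rw [← hp u hu, ← hp v hv, h]
  calc _ ≤ ∑ e ∈ (G.edges.filter (fun e => mEdge H.toEGraph φ e = none)).image (Prod.map a a),
        CE * dist (p e.1) (p e.2) := by
        apply Finset.sum_le_sum_of_subset_of_nonneg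
        · intro x hx
          obtain ⟨hx1, hx2⟩ := Finset.mem_sdiff.1 hx
          obtain ⟨e, he, rfl⟩ := Finset.mem_image.1 hx1
          refine Finset.mem_image_of_mem _ (Finset.mem_filter.2 ⟨he, ?_⟩)
          by_contra hc
          obtain ⟨v, w, hv, hw, hvw⟩ := mEdge_ne_none hc
          apply hx2
          refine Finset.mem_image.2 ⟨(v, w), hvw, ?_⟩
          have e1 := hab _ (G.edge_fst_mem e he) v (H.edge_fst_mem _ hvw) hv
          have e2 := hab _ (G.edge_snd_mem e he) w (H.edge_snd_mem _ hvw) hw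
          exact Prod.ext e1.symm e2.symm
        · intro e _ _; positivity
    _ = _ := by
        rw [Finset.sum_image]
        · apply Finset.sum_congr rfl
          intro e he
          have he' := (Finset.mem_filter.1 he).1
          simp only [Prod.map_fst, Prod.map_snd]
          rw [hp _ (G.edge_fst_mem e he'), hp _ (G.edge_snd_mem e he')]
        · intro x hx y hy hxy
          have hx' := (Finset.mem_filter.1 hx).1
          have hy' := (Finset.mem_filter.1 hy).1
          exact Prod.ext
            (hainj _ (G.edge_fst_mem x hx') _ (G.edge_fst_mem y hy') (congrArg Prod.fst hxy))
            (hainj _ (G.edge_snd_mem x hx') _ (G.edge_snd_mem y hy') (congrArg Prod.snd hxy))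

lemma exists_labels {d : ℕ} (G H : GeoGraph d) (m : Matching d G.toEGraph H.toEGraph) :
    ∃ a b : Pt d → ℕ, Set.InjOn a ↑G.verts ∧ Set.InjOn b ↑H.verts ∧
      ∀ u ∈ G.verts, ∀ v ∈ H.verts, (a u = b v ↔ m.f u = some v) := by
  obtain ⟨enc, henc⟩ := Set.countable_iff_exists_injOn.1
    ((G.verts ∪ H.verts).finite_toSet.countable)
  have hG : ∀ u ∈ G.verts, ∀ v ∈ G.verts, enc u = enc v → u = v := fun u hu v hv h =>
    henc (Finset.mem_coe.2 (Finset.mem_union_left _ hu))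
      (Finset.mem_coe.2 (Finset.mem_union_left _ hv)) h
  have hH : ∀ u ∈ H.verts, ∀ v ∈ H.verts, enc u = enc v → u = v := fun u hu v hv h =>
    henc (Finset.mem_coe.2 (Finset.mem_union_right _ hu))
      (Finset.mem_coe.2 (Finset.mem_union_right _ hv)) h
  let b : Pt d → ℕ := fun v => (m.g v).elim (2 * enc v + 1) (fun u => 2 * enc u)
  have bs : ∀ v u, m.g v = some u → b v = 2 * enc u := by
    intro v u h; simp [b, h]
  have bn : ∀ v, m.g v = none → b v = 2 * enc v + 1 := by
    intro v h; simp [b, h]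
  refine ⟨fun u => 2 * enc u, b, ?_, ?_, ?_⟩
  · intro u hu v hv h
    have h' : 2 * enc u = 2 * enc v := h
    exact hG u hu v hv (by omega)
  · intro v hv w hw h
    have hv : v ∈ H.verts := hv
    have hw : w ∈ H.verts := hw
    cases h1 : m.g v with
    | none =>
      cases h2 : m.g w with
      | none =>
        rw [bn v h1, bn w h2] at h
        exact hH v hv w hw (by omega)
      | some u' =>
        rw [bn v h1, bs w u' h2] at h
        omega
    | some u =>
      cases h2 : m.g w with
      | none =>
        rw [bs v u h1, bn w h2] at h
        omega
      | some u' =>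
        rw [bs v u h1, bs w u' h2] at h
        have hu := m.g_mem v hv u h1
        have hu' := m.g_mem w hw u' h2
        have : u = u' := hG u hu u' hu' (by omega)
        subst this
        have k1 := (m.consistent u hu v hv).2 h1
        have k2 := (m.consistent u hu w hw).2 h2
        exact Option.some.inj (k1.symm.trans k2)
  · intro u hu v hv
    rw [m.consistent u hu v hv]
    cases h1 : m.g v with
    | none =>
      rw [bn v h1]
      constructor
      · intro h
        have h' : 2 * enc u = 2 * enc v + 1 := h
        omega
      · intro h; cases h
    | some w =>
      rw [bs v w h1]
      constructor
      · intro h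
        have h' : 2 * enc u = 2 * enc w := h
        rw [hG u hu w (m.g_mem v hv w h1) (by omega)]
      · intro h
        rw [Option.some.inj h]

lemma upper_path {d : ℕ} (CV CE : ℝ) (hCV : 0 < CV) (hCE : 0 < CE)
    (G H : GeoGraph d) (m : Matching d G.toEGraph H.toEGraph) :
    ∃ (S : EState d) (P : List (EditOp d)), IsEditPathFrom G.toEGraph H.toEGraph S P ∧
      pathCost CV CE S P ≤
        (1 + (max G.toEGraph.maxDegree H.toEGraph.maxDegree : ℝ) * CE / CV) *
          matchCost CV CE m := by
  obtain ⟨a, b, ha, hb, hab⟩ := exists_labels G H m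
  set Δ : ℝ := (max G.toEGraph.maxDegree H.toEGraph.maxDegree : ℝ) with hΔ
  have hΔ0 : 0 ≤ Δ := le_max_of_le_left (Nat.cast_nonneg _)
  let p := Function.invFunOn a (G.verts : Set (Pt d))
  let q := Function.invFunOn b (H.verts : Set (Pt d))
  have hp : ∀ u ∈ G.verts, p (a u) = u := fun u hu =>
    ha.leftInvOn_invFunOn (Finset.mem_coe.2 hu)
  have hq : ∀ u ∈ H.verts, q (b u) = u := fun u hu =>
    hb.leftInvOn_invFunOn (Finset.mem_coe.2 hu)
  obtain ⟨r, hr, P, hP1, hP2, hP3⟩ := reach_states CV CE hCE (G.verts.image a) (H.verts.image b)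
    p q (G.edges.image (Prod.map a a)) (H.edges.image (Prod.map b b)) Δ
    (by
      intro e he
      obtain ⟨x, hx, rfl⟩ := Finset.mem_image.1 he
      exact ⟨Finset.mem_image_of_mem _ (H.edge_fst_mem x hx),
        Finset.mem_image_of_mem _ (H.edge_snd_mem x hx)⟩)
    (by
      intro i hi
      obtain ⟨u, hu, rfl⟩ := Finset.mem_image.1 hi
      have h1 : (G.edges.image (Prod.map a a)).filter (fun e => e.1 = a u ∨ e.2 = a u) ⊆
          (G.edges.filter (fun e => e.1 = u ∨ e.2 = u)).image (Prod.map a a) := by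
        intro x hx
        obtain ⟨hx1, hx2⟩ := Finset.mem_filter.1 hx
        obtain ⟨e, he, rfl⟩ := Finset.mem_image.1 hx1
        refine Finset.mem_image_of_mem _ (Finset.mem_filter.2 ⟨he, ?_⟩)
        rcases hx2 with h | h
        · exact Or.inl (ha (G.edge_fst_mem e he) hu h)
        · exact Or.inr (ha (G.edge_snd_mem e he) hu h)
      have h2 := (Finset.card_le_card h1).trans Finset.card_image_le
      have h3 : G.toEGraph.degree u ≤ G.toEGraph.maxDegree := Finset.le_sup hu
      have h4 := h2.trans h3
      exact le_max_of_le_left (by exact_mod_cast h4))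
    (by
      intro e he
      obtain ⟨x, hx, rfl⟩ := Finset.mem_image.1 he
      intro h
      exact G.edge_ne x hx (ha (G.edge_fst_mem x hx) (G.edge_snd_mem x hx) h))
  refine ⟨_, P, ⟨represents_label G a p hp, hP1, ?_⟩, ?_⟩
  · rw [hP2]
    apply represents_label H b r
    intro u hu
    rw [hr _ (Finset.mem_image_of_mem _ hu), hq u hu]
  refine hP3.trans ?_
  have e1 := sum_edge_label_le CE hCE G H m.f a b p hp
    (fun u hu v hv h => (hab u hu v hv).2 h)
  have e2 := sum_edge_label_le CE hCE H G m.g b a q hq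
    (fun v hv u hu h => ((hab u hu v hv).2 ((m.consistent u hu v hv).2 h)).symm)
  have e3 : ∑ i ∈ G.verts.image a ∩ H.verts.image b, (CV + Δ * CE) * dist (p i) (q i) ≤
      (1 + Δ * CE / CV) *
        ∑ u ∈ G.verts.filter (fun u => m.f u ≠ none), CV * odist (some u) (m.f u) := by
    calc _ ≤ ∑ i ∈ (G.verts.filter (fun u => m.f u ≠ none)).image a,
          (CV + Δ * CE) * dist (p i) (q i) := by
          apply Finset.sum_le_sum_of_subset_of_nonneg
          · intro i hi
            obtain ⟨h1, h2⟩ := Finset.mem_inter.1 hi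
            obtain ⟨u, hu, rfl⟩ := Finset.mem_image.1 h1
            obtain ⟨v, hv, hvu⟩ := Finset.mem_image.1 h2
            have := (hab u hu v hv).1 hvu.symm
            exact Finset.mem_image_of_mem _ (Finset.mem_filter.2 ⟨hu, by simp [this]⟩)
          · intro i _ _; positivity
      _ = _ := by
          rw [Finset.sum_image, Finset.mul_sum]
          · apply Finset.sum_congr rfl
            intro u hu
            obtain ⟨hu1, hu2⟩ := Finset.mem_filter.1 hu
            obtain ⟨v, hv⟩ := Option.ne_none_iff_exists'.1 hu2
            have hvH := m.f_mem u hu1 v hv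
            have hqv : q (a u) = v := by
              rw [(hab u hu1 v hvH).2 hv, hq v hvH]
            rw [hv, hp u hu1, hqv]
            simp only [odist]
            field_simp
          · intro x hx y hy hxy
            exact ha (Finset.mem_filter.1 hx).1 (Finset.mem_filter.1 hy).1 hxy
  have hK : 0 ≤ Δ * CE / CV := by positivity
  unfold matchCost
  set A := ∑ u ∈ G.verts.filter (fun u => m.f u ≠ none), CV * odist (some u) (m.f u)
  have hB : 0 ≤ ∑ e ∈ G.edges.filter (fun e => mEdge H.toEGraph m.f e ≠ none),
      CE * |dist e.1 e.2 - elen (mEdge H.toEGraph m.f e)| :=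
    Finset.sum_nonneg fun e _ => by positivity
  set B := ∑ e ∈ G.edges.filter (fun e => mEdge H.toEGraph m.f e ≠ none),
      CE * |dist e.1 e.2 - elen (mEdge H.toEGraph m.f e)|
  have hC : 0 ≤ ∑ e ∈ G.edges.filter (fun e => mEdge H.toEGraph m.f e = none),
      CE * dist e.1 e.2 := Finset.sum_nonneg fun e _ => by positivity
  set C := ∑ e ∈ G.edges.filter (fun e => mEdge H.toEGraph m.f e = none), CE * dist e.1 e.2
  have hD : 0 ≤ ∑ e ∈ H.edges.filter (fun e => mEdge G.toEGraph m.g e = none),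
      CE * dist e.1 e.2 := Finset.sum_nonneg fun e _ => by positivity
  set D := ∑ e ∈ H.edges.filter (fun e => mEdge G.toEGraph m.g e = none), CE * dist e.1 e.2
  have k1 := mul_nonneg hK hB
  have k2 := mul_nonneg hK hC
  have k3 := mul_nonneg hK hD
  calc _ ≤ C + (1 + Δ * CE / CV) * A + D := by linarith
    _ ≤ _ := by linarith

lemma matchCost_nonneg {d : ℕ} (CV CE : ℝ) (hCV : 0 < CV) (hCE : 0 < CE) {G H : EGraph d}
    (m : Matching d G H) : 0 ≤ matchCost CV CE m := by
  unfold matchCost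
  have h : 0 ≤ ∑ u ∈ G.verts.filter (fun u => m.f u ≠ none), CV * odist (some u) (m.f u) := by
    apply Finset.sum_nonneg
    intro u _
    apply mul_nonneg hCV.le
    cases m.f u with
    | none => exact le_rfl
    | some v => exact dist_nonneg
  have h1 : 0 ≤ ∑ e ∈ G.edges.filter (fun e => mEdge H m.f e ≠ none),
      CE * |dist e.1 e.2 - elen (mEdge H m.f e)| :=
    Finset.sum_nonneg fun e _ => by positivity
  have h2 : 0 ≤ ∑ e ∈ G.edges.filter (fun e => mEdge H m.f e = none),
      CE * dist e.1 e.2 := Finset.sum_nonneg fun e _ => by positivity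
  have h3 : 0 ≤ ∑ e ∈ H.edges.filter (fun e => mEdge G m.g e = none),
      CE * dist e.1 e.2 := Finset.sum_nonneg fun e _ => by positivity
  linarith

/-- For all geometric graphs `G`, `H` of `ℝ^d`,
`GGD(G,H) ≤ GED(G,H) ≤ (1 + Δ·C_E/C_V)·GGD(G,H)`, where `Δ` is the maximum vertex degree
over the graphs `G` and `H`. -/
theorem ggd_le_ged_le_ggd {d : ℕ} (CV CE : ℝ) (hCV : 0 < CV) (hCE : 0 < CE)
    (G H : GeoGraph d) :
    GGD CV CE G H ≤ GED CV CE G H ∧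
    GED CV CE G H ≤
      (1 + (max G.toEGraph.maxDegree H.toEGraph.maxDegree : ℝ) * CE / CV) *
        GGD CV CE G H := by
  have hbdd : BddBelow {c : ℝ | ∃ m : Matching d G.toEGraph H.toEGraph, matchCost CV CE m = c} :=
    ⟨0, by rintro c ⟨m, rfl⟩; exact matchCost_nonneg CV CE hCV hCE m⟩
  have m0 : Matching d G.toEGraph H.toEGraph :=
    ⟨fun _ => none, fun _ => none, by simp, by simp, by simp⟩
  have hlow : ∀ (S : EState d) (P : List (EditOp d)),
      IsEditPathFrom G.toEGraph H.toEGraph S P → GGD CV CE G H ≤ pathCost CV CE S P := by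
    intro S P h
    obtain ⟨hS, hl, hT⟩ := h
    obtain ⟨M, hM1, hM2, hM⟩ := lower_path CV CE hCV hCE P S hS.2.2.1 hl
    refine le_trans (csInf_le hbdd ⟨trackMatching _ _ _ _ M hS hT hM1 hM2, rfl⟩) ?_
    exact (matchCost_track_le CV CE hCV hCE _ _ _ _ M hS hT hM1 hM2).trans (hM _)
  constructor
  · obtain ⟨S, P, hP, -⟩ := upper_path CV CE hCV hCE G H m0
    refine le_csInf ⟨_, S, P, hP, rfl⟩ ?_
    rintro c ⟨S, P, hP, rfl⟩
    exact hlow S P hP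
  · have hbdd' : BddBelow {c : ℝ | ∃ (S : EState d) (P : List (EditOp d)),
        IsEditPathFrom G.toEGraph H.toEGraph S P ∧ pathCost CV CE S P = c} :=
      ⟨GGD CV CE G H, by rintro c ⟨S, P, hP, rfl⟩; exact hlow S P hP⟩
    have hK : 0 < 1 + (max G.toEGraph.maxDegree H.toEGraph.maxDegree : ℝ) * CE / CV := by
      have : (0 : ℝ) ≤ (max G.toEGraph.maxDegree H.toEGraph.maxDegree : ℝ) :=
        le_max_of_le_left (Nat.cast_nonneg _)
      positivity
    rw [← div_le_iff₀' hK]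
    refine le_csInf ⟨_, m0, rfl⟩ ?_
    rintro c ⟨m, rfl⟩
    rw [div_le_iff₀' hK]
    obtain ⟨S, P, hP, hc⟩ := upper_path CV CE hCV hCE G H m
    exact (csInf_le hbdd' ⟨S, P, hP, rfl⟩).trans hc
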